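/- Let 𝒯 be a 2L×2L complex matrix satisfying 𝒯^* J 𝒯 = J, where J = [[0,−1],[1,0]] in L×L blocks, and let 𝒞 = (1/√2)·[[1, −i],[1, i]] in L×L blocks. Then for every unitary L×L matrix U the L×L matrix (U;1)^* · 𝒞 𝒯^* 𝒯 𝒞^* · (U;1) is invertible, where (U;1) is the 2L×L matrix with top block U and bottom block 1, and 2 ∫_{U(L)} [ (U;1)^* 𝒞 𝒯^* 𝒯 𝒞^* (U;1) ]^{-1} dU = 1 with respect to the normalized Haar measure on U(L). -/

import Mathlib

open MeasureTheory Matrix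
open scoped ComplexOrder

noncomputable section

/-- The space of complex `L × L` matrices. -/
abbrev Mat (L : ℕ) := Matrix (Fin L) (Fin L) ℂ

/-- The symplectic form `J = [[0, −1], [1, 0]]` in `L × L` blocks. -/
def symJ (L : ℕ) : Matrix (Fin L ⊕ Fin L) (Fin L ⊕ Fin L) ℂ := Matrix.fromBlocks 0 (-1) 1 0

/-- The Cayley transformation matrix `𝒞 = (1/√2)·[[1, −i],[1, i]]` in `L × L` blocks. -/
def cayley (L : ℕ) : Matrix (Fin L ⊕ Fin L) (Fin L ⊕ Fin L) ℂ :=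
  ((Real.sqrt 2 : ℂ))⁻¹ •
    Matrix.fromBlocks 1 (-(Complex.I • (1 : Mat L))) 1 (Complex.I • (1 : Mat L))

instance (L : ℕ) : MeasurableSpace (Matrix.unitaryGroup (Fin L) ℂ) := borel _

/-- The identity `(1 - x)⁻¹ (1 - x x*) (1 - x*)⁻¹ = (1 - x)⁻¹ + (1 - x*)⁻¹ - 1`
for the Poisson kernel in a ring, where `r` and `s` invert `1 - x` and `1 - y`. -/
theorem poisson_kernel_eq {R : Type*} [Ring R] {x y r s : R}
    (hr : r * (1 - x) = 1) (hs : (1 - y) * s = 1) :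
    r * (1 - x * y) * s = r + s - 1 := by
  have h : 1 - x * y = (1 - y) + (1 - x) - (1 - x) * (1 - y) := by noncomm_ring
  calc r * (1 - x * y) * s
      = r * ((1 - y) * s) + (r * (1 - x)) * s - (r * (1 - x)) * ((1 - y) * s) := by
        rw [h]; noncomm_ring
    _ = r + s - 1 := by rw [hs, hr]; simp

section Contraction

open scoped Matrix.Norms.L2Operator MatrixOrder

variable {L : ℕ}

/-- If `1 - W Wᴴ` is positive definite, then `W` is a strict contraction. -/
theorem l2_opNorm_lt_one_of_posDef [NeZero L] {W : Mat L} (hW : (1 - W * Wᴴ).PosDef) :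
    ‖W‖ < 1 := by
  by_contra! h
  have hnn : 0 ≤ W * Wᴴ := Matrix.nonneg_iff_posSemidef.2 (posSemidef_self_mul_conjTranspose W)
  have hnorm : ‖W * Wᴴ‖ = ‖W‖ * ‖W‖ := CStarRing.norm_self_mul_star
  have hspec := CStarAlgebra.norm_mem_spectrum_of_nonneg hnn
  rw [hnorm, spectrum.mem_iff] at hspec
  refine hspec (Matrix.PosDef.isUnit ?_)
  have hs : (((‖W‖ * ‖W‖ - 1 : ℝ) : ℂ) • (1 : Mat L)).PosSemidef :=
    PosSemidef.one.smul (by exact_mod_cast (by nlinarith : (0 : ℝ) ≤ ‖W‖ * ‖W‖ - 1))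
  have key : algebraMap ℝ (Mat L) (‖W‖ * ‖W‖) - W * Wᴴ
      = (1 - W * Wᴴ) + ((‖W‖ * ‖W‖ - 1 : ℝ) : ℂ) • (1 : Mat L) := by
    rw [Algebra.algebraMap_eq_smul_one, Complex.coe_smul]
    module
  rw [key]
  exact hW.add_posSemidef hs

theorem isUnit_one_sub_of_posDef [NeZero L] {W : Mat L} (hW : (1 - W * Wᴴ).PosDef)
    (U : Matrix.unitaryGroup (Fin L) ℂ) : IsUnit (1 - W * (U : Mat L)) := by
  have hX : ‖W * (U : Mat L)‖ < 1 :=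
    (CStarRing.norm_mul_coe_unitary W U).trans_lt (l2_opNorm_lt_one_of_posDef hW)
  exact isUnit_one_sub_of_norm_lt_one hX

/-- Multiplication of a unitary matrix by a complex number of modulus one. -/
def circleUnitary (L : ℕ) (z : Circle) : Matrix.unitaryGroup (Fin L) ℂ :=
  ⟨(z : ℂ) • 1, by
    rw [Matrix.mem_unitaryGroup_iff, star_smul, star_one, smul_mul_smul_comm, one_mul]
    have : (z : ℂ) * star (z : ℂ) = 1 := by
      simp [Complex.mul_conj]
    rw [this, one_smul]⟩

instance : BorelSpace (Matrix.unitaryGroup (Fin L) ℂ) := ⟨rfl⟩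

/-- The moments `∫ (W U)ⁿ dU` of positive order vanish. -/
theorem integral_mul_unitary_pow (W : Mat L) (μ : Measure (Matrix.unitaryGroup (Fin L) ℂ))
    [μ.IsHaarMeasure] {n : ℕ} (hn : n ≠ 0) :
    ∫ U : Matrix.unitaryGroup (Fin L) ℂ, (W * (U : Mat L)) ^ n ∂μ = 0 := by
  set z : Circle := Circle.exp (Real.pi / n) with hz
  have hzn : (z : ℂ) ^ n = -1 := by
    rw [hz, Circle.coe_exp, ← Complex.exp_nat_mul, ← Complex.exp_pi_mul_I]
    congr 1
    have : (n : ℂ) ≠ 0 := by exact_mod_cast hn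
    push_cast
    field_simp
  have h := integral_mul_left_eq_self (μ := μ)
    (fun U : Matrix.unitaryGroup (Fin L) ℂ => (W * (U : Mat L)) ^ n) (circleUnitary L z)
  have h2 : ∀ U : Matrix.unitaryGroup (Fin L) ℂ,
      (W * ((circleUnitary L z * U : Matrix.unitaryGroup (Fin L) ℂ) : Mat L)) ^ n
        = -(W * (U : Mat L)) ^ n := by
    intro U
    have : W * ((circleUnitary L z * U : Matrix.unitaryGroup (Fin L) ℂ) : Mat L)
        = (z : ℂ) • (W * (U : Mat L)) := by
      simp [circleUnitary]
    rw [this, smul_pow, hzn, neg_one_smul]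
  simp only [h2, integral_neg] at h
  have h3 : (2 : ℂ) • ∫ U : Matrix.unitaryGroup (Fin L) ℂ, (W * (U : Mat L)) ^ n ∂μ = 0 := by
    rw [two_smul]
    nth_rewrite 1 [← h]
    exact neg_add_cancel _
  exact (smul_eq_zero.1 h3).resolve_left two_ne_zero

/-- The mean of the resolvent `(1 - W U)⁻¹` of a strict contraction `W` is the identity. -/
theorem integral_one_sub_inv [NeZero L] {W : Mat L} (hW : (1 - W * Wᴴ).PosDef)
    (μ : Measure (Matrix.unitaryGroup (Fin L) ℂ)) [μ.IsHaarMeasure] [IsProbabilityMeasure μ] :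
    Integrable (fun U : Matrix.unitaryGroup (Fin L) ℂ => (1 - W * (U : Mat L))⁻¹) μ ∧
      ∫ U : Matrix.unitaryGroup (Fin L) ℂ, (1 - W * (U : Mat L))⁻¹ ∂μ = 1 := by
  have hr := l2_opNorm_lt_one_of_posDef hW
  have hX (U : Matrix.unitaryGroup (Fin L) ℂ) : ‖W * (U : Mat L)‖ = ‖W‖ :=
    CStarRing.norm_mul_coe_unitary W U
  have hcont (n : ℕ) :
      Continuous fun U : Matrix.unitaryGroup (Fin L) ℂ => (W * (U : Mat L)) ^ n := by
    fun_prop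
  have hbound (n : ℕ) (U : Matrix.unitaryGroup (Fin L) ℂ) :
      ‖(W * (U : Mat L)) ^ n‖ ≤ ‖W‖ ^ n := (norm_pow_le _ n).trans_eq (by rw [hX])
  have hsum (U : Matrix.unitaryGroup (Fin L) ℂ) :
      HasSum (fun n => (W * (U : Mat L)) ^ n) (1 - W * (U : Mat L))⁻¹ := by
    rw [nonsing_inv_eq_ringInverse]
    exact hasSum_geom_series_inverse _ (by rw [hX]; exact hr)
  have hgeom := summable_geometric_of_lt_one (norm_nonneg W) hr
  have hmeas (n : ℕ) : AEStronglyMeasurable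
      (fun U : Matrix.unitaryGroup (Fin L) ℂ => (W * (U : Mat L)) ^ n) μ :=
    (hcont n).aestronglyMeasurable
  refine ⟨?_, ?_⟩
  · refine Integrable.of_bound (C := ∑' n, ‖W‖ ^ n) ?_ (ae_of_all _ fun U => ?_)
    · exact aestronglyMeasurable_of_tendsto_ae Filter.atTop
        (f := fun N (U : Matrix.unitaryGroup (Fin L) ℂ) =>
          ∑ n ∈ Finset.range N, (W * (U : Mat L)) ^ n)
        (fun N => (continuous_finsetSum _ fun n _ => hcont n).aestronglyMeasurable)
        (ae_of_all _ fun U => (hsum U).tendsto_sum_nat)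
    · rw [← (hsum U).tsum_eq]
      exact tsum_of_norm_bounded hgeom.hasSum fun n => hbound n U
  · have h := hasSum_integral_of_dominated_convergence (μ := μ) (fun n _ => ‖W‖ ^ n) hmeas
      (fun n => ae_of_all _ (hbound n)) (ae_of_all _ fun _ => hgeom) (integrable_const _)
      (ae_of_all _ hsum)
    have h1 := hasSum_single (f := fun n => ∫ U : Matrix.unitaryGroup (Fin L) ℂ,
      (W * (U : Mat L)) ^ n ∂μ) 0 fun n hn => integral_mul_unitary_pow W μ hn
    have h0 : ∫ U : Matrix.unitaryGroup (Fin L) ℂ, (W * (U : Mat L)) ^ 0 ∂μ = 1 := by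
      simp
    exact (h.unique h1).trans h0

/-- The mean of the Poisson kernel of a strict contraction `W` is the identity, entrywise. -/
theorem integral_poisson_kernel_apply [NeZero L] {W : Mat L} (hW : (1 - W * Wᴴ).PosDef)
    (μ : Measure (Matrix.unitaryGroup (Fin L) ℂ)) [μ.IsHaarMeasure] [IsProbabilityMeasure μ]
    (i j : Fin L) :
    ∫ U : Matrix.unitaryGroup (Fin L) ℂ,
      ((1 - W * (U : Mat L))⁻¹ + ((1 - W * (U : Mat L))⁻¹)ᴴ - 1 : Mat L) i j ∂μ = (1 : Mat L) i j := by
  obtain ⟨hint, hone⟩ := integral_one_sub_inv hW μ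
  have hentry (k l : Fin L) :
      Integrable (fun U : Matrix.unitaryGroup (Fin L) ℂ => (1 - W * (U : Mat L))⁻¹ k l) μ ∧
      ∫ U : Matrix.unitaryGroup (Fin L) ℂ, (1 - W * (U : Mat L))⁻¹ k l ∂μ = (1 : Mat L) k l := by
    let e : Mat L →L[ℂ] ℂ := LinearMap.toContinuousLinearMap (Matrix.entryLinearMap ℂ ℂ k l)
    refine ⟨e.integrable_comp hint, ?_⟩
    have := e.integral_comp_comm hint
    rw [hone] at this
    exact this
  have hconj : Integrable (fun U : Matrix.unitaryGroup (Fin L) ℂ =>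
      ((1 - W * (U : Mat L))⁻¹)ᴴ i j) μ :=
    (Complex.conjCLE : ℂ →L[ℝ] ℂ).integrable_comp (hentry j i).1
  have hconj' : ∫ U : Matrix.unitaryGroup (Fin L) ℂ, ((1 - W * (U : Mat L))⁻¹)ᴴ i j ∂μ
      = (1 : Mat L) i j := by
    refine (integral_conj (μ := μ)
      (f := fun U : Matrix.unitaryGroup (Fin L) ℂ => (1 - W * (U : Mat L))⁻¹ j i)).trans ?_
    rw [(hentry j i).2]
    exact congr_fun₂ (conjTranspose_one (n := Fin L) (α := ℂ)) i j
  have hadd := integral_add (hentry i j).1 hconj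
  rw [(hentry i j).2, hconj'] at hadd
  refine (integral_sub ((hentry i j).1.add hconj) (integrable_const ((1 : Mat L) i j))).trans ?_
  refine (congrArg₂ (· - ·) hadd (integral_const ((1 : Mat L) i j))).trans ?_
  simp

end Contraction

section Pseudounitary

variable {L : ℕ}

/-- The signature matrix `diag(1, -1)` in `L × L` blocks. -/
def signature (L : ℕ) : Matrix (Fin L ⊕ Fin L) (Fin L ⊕ Fin L) ℂ :=
  Matrix.fromBlocks 1 0 0 (-1)

theorem signature_mul_self (L : ℕ) : signature L * signature L = 1 := by
  simp [signature, fromBlocks_multiply]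

theorem inv_sqrt_two_mul_self : ((Real.sqrt 2 : ℂ))⁻¹ * ((Real.sqrt 2 : ℂ))⁻¹ = 1 / 2 := by
  rw [← mul_inv, ← Complex.ofReal_mul, Real.mul_self_sqrt zero_le_two]
  norm_num

theorem cayley_conjTranspose_mul_self (L : ℕ) : (cayley L)ᴴ * cayley L = 1 := by
  simp only [cayley, conjTranspose_smul, fromBlocks_conjTranspose, smul_mul_smul_comm,
    fromBlocks_multiply, fromBlocks_smul]
  simp [smul_smul, inv_sqrt_two_mul_self, ← add_smul, ← fromBlocks_one]
  norm_num

theorem cayley_conjTranspose_mul_signature_mul (L : ℕ) :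
    (cayley L)ᴴ * signature L * cayley L = Complex.I • symJ L := by
  simp only [cayley, symJ, signature, conjTranspose_smul, fromBlocks_conjTranspose,
    smul_mul_assoc, mul_smul_comm, smul_smul, fromBlocks_multiply, fromBlocks_smul]
  have h := inv_sqrt_two_mul_self
  simp [smul_smul]
  refine ⟨?_, ?_, ?_⟩ <;> match_scalars
  · linear_combination (-2 * Complex.I) * h
  · linear_combination (2 * Complex.I) * h
  · ring

/-- The Cayley transform of a hermitian symplectic matrix preserves the signature form. -/
theorem cayley_conj_signature {𝒯 : Matrix (Fin L ⊕ Fin L) (Fin L ⊕ Fin L) ℂ}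
    (h𝒯 : 𝒯ᴴ * symJ L * 𝒯 = symJ L) :
    (cayley L * 𝒯 * (cayley L)ᴴ)ᴴ * signature L * (cayley L * 𝒯 * (cayley L)ᴴ)
      = signature L := by
  have hC' : cayley L * (cayley L)ᴴ = 1 := mul_eq_one_comm.1 (cayley_conjTranspose_mul_self L)
  calc (cayley L * 𝒯 * (cayley L)ᴴ)ᴴ * signature L * (cayley L * 𝒯 * (cayley L)ᴴ)
      = cayley L * (𝒯ᴴ * ((cayley L)ᴴ * signature L * cayley L) * 𝒯) * (cayley L)ᴴ := by
        simp only [conjTranspose_mul, conjTranspose_conjTranspose, mul_assoc]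
    _ = cayley L * ((cayley L)ᴴ * signature L * cayley L) * (cayley L)ᴴ := by
        rw [cayley_conjTranspose_mul_signature_mul, mul_smul_comm, smul_mul_assoc, h𝒯]
    _ = (cayley L * (cayley L)ᴴ) * signature L * (cayley L * (cayley L)ᴴ) := by
        simp only [mul_assoc]
    _ = signature L := by rw [hC', one_mul, mul_one]

/-- A matrix preserving the signature form also preserves its inverse. -/
theorem mul_signature_mul_conjTranspose {S : Matrix (Fin L ⊕ Fin L) (Fin L ⊕ Fin L) ℂ}
    (hS : Sᴴ * signature L * S = signature L) : S * signature L * Sᴴ = signature L := by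
  have h1 : (signature L * Sᴴ * signature L) * S = 1 := by
    rw [mul_assoc (signature L), mul_assoc (signature L), hS, signature_mul_self]
  have h2 := mul_eq_one_comm.1 h1
  calc S * signature L * Sᴴ
      = S * (signature L * Sᴴ * signature L) * signature L := by
        simp only [mul_assoc, signature_mul_self, mul_one]
    _ = signature L := by rw [h2, one_mul]

variable {A B C D : Mat L}

open scoped MatrixOrder in
theorem isUnit_of_signature
    (hS : (fromBlocks A B C D)ᴴ * signature L * fromBlocks A B C D = signature L) :
    IsUnit D := by
  have h : Bᴴ * B - Dᴴ * D = -1 := by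
    simp only [signature, fromBlocks_conjTranspose, fromBlocks_multiply] at hS
    simpa [sub_eq_add_neg] using (fromBlocks_inj.1 hS).2.2.2
  have hD : Dᴴ * D = 1 + Bᴴ * B := by
    linear_combination (norm := abel) -h
  have hpos : (Dᴴ * D).PosDef := by
    rw [hD]
    exact PosDef.one.add_posSemidef (posSemidef_conjTranspose_mul_self B)
  exact isUnit_of_mul_isUnit_right hpos.isUnit

theorem one_sub_mul_conjTranspose_of_signature
    (hS : (fromBlocks A B C D)ᴴ * signature L * fromBlocks A B C D = signature L) :
    1 - (-(D⁻¹ * C)) * (-(D⁻¹ * C))ᴴ = D⁻¹ * (D⁻¹)ᴴ := by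
  have hD := (Matrix.isUnit_iff_isUnit_det _).1 (isUnit_of_signature hS)
  have h : C * Cᴴ = D * Dᴴ - 1 := by
    have hS' := mul_signature_mul_conjTranspose hS
    simp only [signature, fromBlocks_conjTranspose, fromBlocks_multiply] at hS'
    have := (fromBlocks_inj.1 hS').2.2.2
    simp only [mul_one, mul_zero, mul_neg, neg_mul, zero_add, add_zero] at this
    linear_combination (norm := abel) this
  have h1 : D⁻¹ * D = 1 := nonsing_inv_mul _ hD
  have h2 : Dᴴ * (D⁻¹)ᴴ = 1 := by rw [← conjTranspose_mul, h1, conjTranspose_one]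
  calc 1 - (-(D⁻¹ * C)) * (-(D⁻¹ * C))ᴴ = 1 - D⁻¹ * (C * Cᴴ) * (D⁻¹)ᴴ := by
        simp only [conjTranspose_neg, neg_mul_neg, conjTranspose_mul, mul_assoc]
    _ = 1 - (D⁻¹ * D) * (Dᴴ * (D⁻¹)ᴴ) + D⁻¹ * (D⁻¹)ᴴ := by rw [h]; noncomm_ring
    _ = D⁻¹ * (D⁻¹)ᴴ := by rw [h1, h2]; simp

open scoped MatrixOrder in
theorem posDef_one_sub_of_signature
    (hS : (fromBlocks A B C D)ᴴ * signature L * fromBlocks A B C D = signature L) :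
    (1 - (-(D⁻¹ * C)) * (-(D⁻¹ * C))ᴴ).PosDef := by
  rw [one_sub_mul_conjTranspose_of_signature hS]
  refine (posSemidef_self_mul_conjTranspose _).posDef_iff_isUnit.2 ?_
  have hD : IsUnit D⁻¹ := isUnit_nonsing_inv_iff.2 (isUnit_of_signature hS)
  exact hD.mul hD.star

/-- The compression of `Sᴴ S` to the graph of a unitary `U`, for `S` preserving the
signature form. -/
theorem compression_eq_of_signature
    (hS : (fromBlocks A B C D)ᴴ * signature L * fromBlocks A B C D = signature L)
    (U : Matrix.unitaryGroup (Fin L) ℂ) :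
    (fromRows (U : Mat L) (1 : Mat L))ᴴ * ((fromBlocks A B C D)ᴴ * fromBlocks A B C D)
        * fromRows (U : Mat L) (1 : Mat L)
      = (2 : ℂ) • ((C * (U : Mat L) + D)ᴴ * (C * (U : Mat L) + D)) := by
  set V := fromRows (U : Mat L) (1 : Mat L) with hV
  set S := fromBlocks A B C D with hS_def
  have hSV : S * V = fromRows (A * (U : Mat L) + B) (C * (U : Mat L) + D) := by
    simp [hV, hS_def, fromBlocks_mul_fromRows]
  have hU : (U : Mat L)ᴴ * (U : Mat L) = 1 := Matrix.mem_unitaryGroup_iff'.1 U.2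
  have hVV : Vᴴ * signature L * V = 0 := by
    rw [Matrix.mul_assoc, hV, signature, fromBlocks_mul_fromRows,
      conjTranspose_fromRows_eq_fromCols_conjTranspose, fromCols_mul_fromRows]
    simp [hU]
  have hzero : (S * V)ᴴ * signature L * (S * V) = 0 := by
    calc (S * V)ᴴ * signature L * (S * V) = Vᴴ * (Sᴴ * signature L * S) * V := by
          simp only [conjTranspose_mul, Matrix.mul_assoc]
      _ = 0 := by rw [hS, hVV]
  have hsum : Vᴴ * (Sᴴ * S) * V = (S * V)ᴴ * (S * V) := by
    simp only [conjTranspose_mul, Matrix.mul_assoc]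
  rw [hSV, Matrix.mul_assoc, signature, fromBlocks_mul_fromRows,
    conjTranspose_fromRows_eq_fromCols_conjTranspose, fromCols_mul_fromRows] at hzero
  rw [hsum, hSV, conjTranspose_fromRows_eq_fromCols_conjTranspose, fromCols_mul_fromRows]
  simp only [Matrix.one_mul, Matrix.zero_mul, add_zero, zero_add, Matrix.neg_mul,
    Matrix.mul_neg] at hzero
  rw [two_smul]
  linear_combination (norm := abel) hzero

/-- The compression of `Sᴴ S` to the graph of a unitary `U` is inverted by half the Poisson
kernel of `-D⁻¹ C`. -/
theorem compression_mul_poisson_kernel [NeZero L]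
    (hS : (fromBlocks A B C D)ᴴ * signature L * fromBlocks A B C D = signature L)
    (U : Matrix.unitaryGroup (Fin L) ℂ) :
    ((fromRows (U : Mat L) (1 : Mat L))ᴴ * ((fromBlocks A B C D)ᴴ * fromBlocks A B C D)
        * fromRows (U : Mat L) (1 : Mat L))
      * ((1 / 2 : ℂ) • ((1 - (-(D⁻¹ * C)) * (U : Mat L))⁻¹
          + ((1 - (-(D⁻¹ * C)) * (U : Mat L))⁻¹)ᴴ - 1)) = 1 := by
  set W := -(D⁻¹ * C) with hW
  set X := W * (U : Mat L) with hX
  have hD := (Matrix.isUnit_iff_isUnit_det _).1 (isUnit_of_signature hS)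
  have hX_unit := (Matrix.isUnit_iff_isUnit_det _).1
    (isUnit_one_sub_of_posDef (posDef_one_sub_of_signature hS) U)
  have hU : (U : Mat L) * (U : Mat L)ᴴ = 1 := Matrix.mem_unitaryGroup_iff.1 U.2
  have hXX : 1 - X * Xᴴ = D⁻¹ * (D⁻¹)ᴴ := by
    rw [← one_sub_mul_conjTranspose_of_signature hS, ← hW, hX, conjTranspose_mul]
    congr 1
    calc W * (U : Mat L) * ((U : Mat L)ᴴ * Wᴴ) = W * ((U : Mat L) * (U : Mat L)ᴴ) * Wᴴ := by
          simp only [mul_assoc]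
      _ = W * Wᴴ := by rw [hU, mul_one]
  set R := (1 - X)⁻¹ with hR
  have hXR : (1 - X) * R = 1 := mul_nonsing_inv _ hX_unit
  have hRX : R * (1 - X) = 1 := nonsing_inv_mul _ hX_unit
  have hXR' : (1 - Xᴴ) * Rᴴ = 1 := by
    have := congrArg conjTranspose hRX
    simpa [conjTranspose_mul] using this
  have hDD : D * D⁻¹ = 1 := mul_nonsing_inv _ hD
  have hDD' : Dᴴ * (D⁻¹)ᴴ = 1 := by
    rw [← conjTranspose_mul, nonsing_inv_mul _ hD, conjTranspose_one]
  have hfac : C * (U : Mat L) + D = D * (1 - X) := by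
    rw [hX, hW, mul_sub, neg_mul, mul_neg, mul_one, ← mul_assoc, ← mul_assoc, hDD, one_mul]
    abel
  rw [compression_eq_of_signature hS, hfac, smul_mul_smul_comm,
    ← poisson_kernel_eq hRX hXR', hXX]
  have : (D * (1 - X))ᴴ * (D * (1 - X)) * (R * (D⁻¹ * D⁻¹ᴴ) * Rᴴ) = 1 := by
    calc (D * (1 - X))ᴴ * (D * (1 - X)) * (R * (D⁻¹ * D⁻¹ᴴ) * Rᴴ)
        = (1 - Xᴴ) * Dᴴ * (D * ((1 - X) * R) * D⁻¹) * D⁻¹ᴴ * Rᴴ := by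
          simp only [conjTranspose_mul, conjTranspose_sub, conjTranspose_one, mul_assoc]
      _ = (1 - Xᴴ) * (Dᴴ * D⁻¹ᴴ) * Rᴴ := by
          rw [hXR, mul_one, hDD, mul_one]; simp only [mul_assoc]
      _ = 1 := by rw [hDD', mul_one, hXR']
  rw [this]
  norm_num

end Pseudounitary

theorem stmt11 (L : ℕ) (hL : 1 ≤ L)
    (𝒯 : Matrix (Fin L ⊕ Fin L) (Fin L ⊕ Fin L) ℂ)
    (h𝒯 : 𝒯ᴴ * symJ L * 𝒯 = symJ L)
    (μ : Measure (Matrix.unitaryGroup (Fin L) ℂ))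
    [μ.IsHaarMeasure] [IsProbabilityMeasure μ] :
    (∀ U : Matrix.unitaryGroup (Fin L) ℂ,
      IsUnit ((Matrix.fromRows (U : Mat L) (1 : Mat L))ᴴ
        * (cayley L * 𝒯ᴴ * 𝒯 * (cayley L)ᴴ) * Matrix.fromRows (U : Mat L) (1 : Mat L))) ∧
    (∀ i j : Fin L,
      2 * (∫ (U : Matrix.unitaryGroup (Fin L) ℂ),
          ((Matrix.fromRows (U : Mat L) (1 : Mat L))ᴴ
            * (cayley L * 𝒯ᴴ * 𝒯 * (cayley L)ᴴ)
            * Matrix.fromRows (U : Mat L) (1 : Mat L))⁻¹ i j ∂μ) = (1 : Mat L) i j) := by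
  have : NeZero L := ⟨by omega⟩
  set S := cayley L * 𝒯 * (cayley L)ᴴ with hS_def
  have hS : Sᴴ * signature L * S = signature L := cayley_conj_signature h𝒯
  have hM : cayley L * 𝒯ᴴ * 𝒯 * (cayley L)ᴴ = Sᴴ * S := by
    calc cayley L * 𝒯ᴴ * 𝒯 * (cayley L)ᴴ
        = cayley L * 𝒯ᴴ * ((cayley L)ᴴ * cayley L) * 𝒯 * (cayley L)ᴴ := by
          rw [cayley_conjTranspose_mul_self, mul_one]
      _ = Sᴴ * S := by
          simp only [hS_def, conjTranspose_mul, conjTranspose_conjTranspose, mul_assoc]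
  rw [hM]
  rw [← fromBlocks_toBlocks S] at hS ⊢
  have hinv := fun U => compression_mul_poisson_kernel hS U
  refine ⟨fun U => IsUnit.of_mul_eq_one _ (hinv U), fun i j => ?_⟩
  simp only [fun U => inv_eq_right_inv (hinv U)]
  rw [← integral_poisson_kernel_apply (posDef_one_sub_of_signature hS) μ i j,
    ← integral_const_mul]
  congr 1
  funext U
  rw [Matrix.smul_apply, smul_eq_mul]
  ring
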